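/- arXiv:2209.15492 — 5 statements merged into one kernel-verified Lean document; each statement's English description precedes it below -/
import Mathlib

section
/- Let R be a Euclidean domain with fraction field K, S a Dedekind domain that is the integral closure of R in L, where L is a finite separable field extension of K, and let abv be an absolute value on R with values in ℤ. Let I be a nonzero ideal of S and M a finite set of elements of R whose images in S are all nonzero. If for all a, b ∈ S with b ≠ 0 there exist q ∈ S and r ∈ M such that abv(Norm_R(r•a − q*b)) < abv(Norm_R(b)), then there exists a nonzero ideal J of S such that I and J have the same class in the class group of S and the image in S of the product of all elements of M lies in J. -/
open scoped nonZeroDivisors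

/-- Let `R` be a Euclidean domain with fraction field `K`, and `S` a Dedekind domain that
is the integral closure of `R` in a finite separable field extension `L` of `K`. Let
`abv` be an absolute value on `R` with values in `ℤ`, `I` a nonzero ideal of `S`, and
`M` a finite set of elements of `R` with nonzero images in `S`. If for all `a, b ∈ S`
with `b ≠ 0` there are `q ∈ S` and `r ∈ M` with
`abv (Norm_R (r • a - q * b)) < abv (Norm_R b)`, then there is a nonzero ideal `J` of `S`
in the same ideal class as `I` such that the image in `S` of the product of the elements
of `M` lies in `J`. -/
theorem exists_mk0_eq_mk0' {R S : Type*} (K L : Type*) [EuclideanDomain R]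
    [CommRing S] [IsDomain S] [IsDedekindDomain S] [Field K] [Field L]
    [Algebra R K] [IsFractionRing R K]
    [Algebra K L] [FiniteDimensional K L] [Algebra.IsSeparable K L]
    [Algebra R L] [IsScalarTower R K L]
    [Algebra R S] [Algebra S L] [IsScalarTower R S L]
    [IsIntegralClosure S R L]
    (abv : AbsoluteValue R ℤ)
    (I : (Ideal S)⁰) (M : Finset R)
    (hM : ∀ m ∈ M, algebraMap R S m ≠ 0)
    (h : ∀ a : S, ∀ b : S, b ≠ 0 → ∃ q : S, ∃ r ∈ M,
      abv (Algebra.norm R (r • a - q * b)) < abv (Algebra.norm R b)) :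
    ∃ J : (Ideal S)⁰, ClassGroup.mk0 I = ClassGroup.mk0 J ∧
      algebraMap R S (∏ m ∈ M, m) ∈ (J : Ideal S) := by
  have hprod : algebraMap R S (∏ m ∈ M, m) ≠ 0 := by
    rw [map_prod]
    exact Finset.prod_ne_zero_iff.mpr hM
  obtain ⟨b, b_mem, b_ne_zero, b_min⟩ := ClassGroup.exists_min abv I
  have hdvd : Ideal.span {b} ∣ Ideal.span {algebraMap R S (∏ m ∈ M, m)} * I.1 := by
    rw [Ideal.dvd_iff_le, Ideal.mul_le]
    intro r' hr' a ha
    rw [Ideal.mem_span_singleton] at hr' ⊢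
    obtain ⟨q, r, r_mem, lt⟩ := h a b b_ne_zero
    have hqr : r • a = q * b := sub_eq_zero.mp <| b_min _
      (I.1.sub_mem (Submodule.smul_of_tower_mem I.1 r ha) (I.1.mul_mem_left _ b_mem)) lt
    refine (Dvd.intro_left q hqr.symm).trans ?_
    rw [Algebra.smul_def]
    exact mul_dvd_mul_right ((map_dvd _ (Finset.dvd_prod_of_mem _ r_mem)).trans hr') _
  obtain ⟨J, hJ⟩ := hdvd
  refine ⟨⟨J, ?_⟩, ?_, ?_⟩
  · rw [mem_nonZeroDivisors_iff_ne_zero]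
    rintro rfl
    rw [mul_zero] at hJ
    exact hprod (Ideal.span_singleton_eq_bot.mp (I.2.2 _ hJ))
  · rw [ClassGroup.mk0_eq_mk0_iff]
    exact ⟨_, b, hprod, b_ne_zero, hJ⟩
  · rw [← Ideal.span_singleton_le_iff_mem, ← Ideal.dvd_iff_le]
    apply (mul_dvd_mul_iff_left (mt Ideal.span_singleton_eq_bot.mp b_ne_zero)).mp
    rw [Ideal.dvd_iff_le, ← hJ, mul_comm]
    exact Ideal.mul_mono le_rfl ((Ideal.span_singleton_le_iff_mem _).mpr b_mem)
end

section
/- Let d be an integer with −6 ≤ d ≤ 0 and d ≡ 2 or 3 (mod 4), and let d' be the image of d in ℚ; assume d' is not a square in ℚ. Then for every element γ of the quadratic field ℚ(√d') there exist q ∈ ℤ[√d] and r ∈ {1, 2} such that |Norm_ℚ(r•γ − q•1)| < 1. -/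
open Polynomial

noncomputable section

theorem root_sq (q : ℚ) :
    AdjoinRoot.root (X ^ 2 - C q) * AdjoinRoot.root (X ^ 2 - C q) =
      algebraMap ℚ (AdjoinRoot (X ^ 2 - C q)) q := by
  have h := AdjoinRoot.mk_self (f := X ^ 2 - C q)
  rw [map_sub, map_pow, AdjoinRoot.mk_X, sub_eq_zero] at h
  rw [← pow_two, h, AdjoinRoot.mk_C, AdjoinRoot.algebraMap_eq]

/-- The canonical ring homomorphism from `ℤ[√d]` into the quadratic field `ℚ(√d)`,
realized as `AdjoinRoot (X² - d)` over `ℚ`, sending `√d` to a root of `X² - d`. -/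
def sqrtdMap (d : ℤ) : ℤ√d →+* AdjoinRoot (X ^ 2 - C (d : ℚ)) :=
  Zsqrtd.lift ⟨AdjoinRoot.root _, by rw [root_sq]; exact map_intCast _ d⟩

instance algebraZsqrtd (d : ℤ) : Algebra (ℤ√d) (AdjoinRoot (X ^ 2 - C (d : ℚ))) :=
  (sqrtdMap d).toAlgebra

theorem exists_eq_algebraMap_add_mul_root (q : ℚ) (γ : AdjoinRoot (X ^ 2 - C q)) :
    ∃ a b : ℚ, γ = algebraMap ℚ _ a + algebraMap ℚ _ b * AdjoinRoot.root (X ^ 2 - C q) := by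
  induction γ using AdjoinRoot.induction_on with
  | ih p =>
    induction p using Polynomial.induction_on' with
    | add p p' hp hp' =>
      obtain ⟨a, b, h⟩ := hp
      obtain ⟨a', b', h'⟩ := hp'
      refine ⟨a + a', b + b', ?_⟩
      rw [map_add, h, h', map_add, map_add]
      ring
    | monomial n c =>
      induction n with
      | zero => exact ⟨c, 0, by simp [AdjoinRoot.algebraMap_eq]⟩
      | succ n ih =>
        obtain ⟨a, b, h⟩ := ih
        refine ⟨b * q, a, ?_⟩
        rw [← monomial_mul_X, map_mul, h, AdjoinRoot.mk_X, map_mul, ← root_sq]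
        ring

/-- The norm form of `ℚ[X]/(X² - q)`. -/
theorem norm_algebraMap_add_mul_root (q a b : ℚ) :
    Algebra.norm ℚ (algebraMap ℚ (AdjoinRoot (X ^ 2 - C q)) a +
      algebraMap ℚ _ b * AdjoinRoot.root (X ^ 2 - C q)) = a ^ 2 - q * b ^ 2 := by
  set θ := AdjoinRoot.root (X ^ 2 - C q)
  let pb := AdjoinRoot.powerBasis' (monic_X_pow_sub_C q two_ne_zero)
  have hdim : pb.dim = 2 := natDegree_X_pow_sub_C
  let B := pb.basis.reindex (finCongr hdim)
  have hB0 : B 0 = 1 := by simp [B, pb]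
  have hB1 : B 1 = θ := by simp [B, pb, θ]
  have h0 : (algebraMap ℚ _ a + algebraMap ℚ _ b * θ) * B 0 = a • B 0 + b • B 1 := by
    rw [hB0, hB1, Algebra.smul_def, Algebra.smul_def]
    ring
  have h1 : (algebraMap ℚ _ a + algebraMap ℚ _ b * θ) * B 1 = (q * b) • B 0 + a • B 1 := by
    rw [hB0, hB1, Algebra.smul_def, Algebra.smul_def, map_mul, ← root_sq]
    ring
  rw [Algebra.norm_eq_matrix_det B, Matrix.det_fin_two]
  simp only [Algebra.leftMulMatrix_eq_repr_mul, h0, h1, map_add, map_smul, B.repr_self]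
  simp
  ring

theorem exists_int_sub_sq_le (x : ℚ) : ∃ m : ℤ, (x - m) ^ 2 ≤ 1 / 4 := by
  refine ⟨round x, ?_⟩
  have := abs_le.mp (abs_sub_round x)
  nlinarith

/-- Every rational point comes within distance one of the lattice for the form `x² + n y²`,
possibly after doubling, as soon as `n ≤ 6`. -/
theorem exists_mul_sub_sq_add_lt_one {n : ℚ} (hn' : n ≤ 6) (a b : ℚ) :
    ∃ r ∈ ({1, 2} : Finset ℤ), ∃ u v : ℤ, (r * a - u) ^ 2 + n * (r * b - v) ^ 2 < 1 := by
  obtain ⟨u, hu⟩ := exists_int_sub_sq_le a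
  obtain ⟨u', hu'⟩ := exists_int_sub_sq_le (2 * a)
  have hb := abs_le.mp (abs_sub_round b)
  set v := round b
  by_cases h : n * (b - v) ^ 2 < 3 / 4
  · exact ⟨1, by simp, u, v, by push_cast; linarith⟩
  have key : ∀ t : ℚ, 0 ≤ t → t ≤ 1 / 2 → 3 / 4 ≤ n * t ^ 2 → n * (2 * t - 1) ^ 2 < 3 / 4 := by
    intro t ht ht' hnt
    have h3 : 1 / 3 < t := by nlinarith
    have h9 : (2 * t - 1) ^ 2 ≤ 1 / 9 := by nlinarith
    nlinarith [sq_nonneg (2 * t - 1)]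
  rcases le_total 0 (b - v) with hs | hs
  · have := key (b - v) hs (by linarith) (by linarith)
    refine ⟨2, by simp, u', 2 * v + 1, ?_⟩
    push_cast
    linarith
  · have := key (v - b) (by linarith) (by linarith) (by linarith)
    refine ⟨2, by simp, u', 2 * v - 1, ?_⟩
    push_cast
    linarith

/-- For an integer `d` with `-6 ≤ d ≤ 0`, `d ≡ 2` or `3 (mod 4)`, whose image `d'` in `ℚ`
is not a square, and for every `γ` in the quadratic field `ℚ(√d') = ℚ[X]/(X² - d')`,
there are `q ∈ ℤ[√d]` and `r ∈ {1, 2}` with `|Norm_ℚ (r • γ - q • 1)| < 1`. -/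
theorem sqrt_neg_exists_q_r (d : ℤ) (hle : -6 ≤ d) (hge : d ≤ 0)
    (hmod : d % 4 = 2 ∨ d % 4 = 3) (hsq : ¬ IsSquare ((d : ℚ)))
    (γ : AdjoinRoot (X ^ 2 - C (d : ℚ))) :
    ∃ q : ℤ√d, ∃ r ∈ ({1, 2} : Finset ℤ),
      |Algebra.norm ℚ (r • γ - q • (1 : AdjoinRoot (X ^ 2 - C (d : ℚ))))| < 1 := by
  obtain ⟨a, b, rfl⟩ := exists_eq_algebraMap_add_mul_root _ γ
  have hd : (d : ℚ) ≤ 0 := by exact_mod_cast hge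
  have hd' : (-6 : ℚ) ≤ d := by exact_mod_cast hle
  obtain ⟨r, hr, u, v, h⟩ :=
    exists_mul_sub_sq_add_lt_one (n := -d) (by linarith) a b
  refine ⟨⟨u, v⟩, r, hr, ?_⟩
  have hq : (⟨u, v⟩ : ℤ√d) • (1 : AdjoinRoot (X ^ 2 - C (d : ℚ))) =
      (u : AdjoinRoot (X ^ 2 - C (d : ℚ))) + (v : AdjoinRoot (X ^ 2 - C (d : ℚ))) *
        AdjoinRoot.root (X ^ 2 - C (d : ℚ)) := by
    rw [Algebra.smul_def, mul_one]
    rfl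
  have key : r • (algebraMap ℚ (AdjoinRoot (X ^ 2 - C (d : ℚ))) a +
        algebraMap ℚ _ b * AdjoinRoot.root (X ^ 2 - C (d : ℚ))) - (⟨u, v⟩ : ℤ√d) • 1 =
      algebraMap ℚ _ (r * a - u) +
        algebraMap ℚ _ (r * b - v) * AdjoinRoot.root (X ^ 2 - C (d : ℚ)) := by
    rw [hq, zsmul_eq_mul]
    simp only [map_sub, map_mul, map_intCast]
    ring
  rw [key, norm_algebraMap_add_mul_root, abs_lt]
  constructor <;> nlinarith [sq_nonneg (r * a - u), sq_nonneg (r * b - v)]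

end
end

section
/- Let d be a squarefree integer with −6 ≤ d ≤ 0 and d ≡ 2 or 3 (mod 4). Then every element of the class group of ℤ[√d] is either the trivial class or the class of the ideal √2 of ℤ[√d], where √2 is the ideal ⟨√d, 2⟩ if d ≡ 2 (mod 4) and ⟨1 + √d, 2⟩ if d ≡ 3 (mod 4). In particular the class group of ℤ[√d] has at most 2 elements. -/
open scoped nonZeroDivisors

/-- The ideal `√2` of `ℤ[√d]`: it is `⟨√d, 2⟩` if `d ≡ 2 (mod 4)` and `⟨1 + √d, 2⟩`
if `d ≡ 3 (mod 4)`. -/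
def sqrtTwo (d : ℤ) : Ideal (ℤ√d) :=
  if d % 4 = 2 then Ideal.span {(⟨0, 1⟩ : ℤ√d), 2} else Ideal.span {(⟨1, 1⟩ : ℤ√d), 2}

theorem sqrtTwo_ne_zero (d : ℤ) : sqrtTwo d ≠ 0 := by
  have h2 : (2 : ℤ√d) ≠ 0 := by
    intro h
    simpa using congrArg Zsqrtd.re h
  unfold sqrtTwo
  split <;>
  · intro h
    rw [Ideal.zero_eq_bot] at h
    exact h2 (Ideal.mem_bot.mp (h ▸ Ideal.subset_span (by simp)))

/-- Rounding to a nearest multiple. -/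
theorem exists_two_mul_abs_sub_mul_le (a : ℤ) {n : ℤ} (hn : 0 < n) :
    ∃ q : ℤ, 2 * |a - q * n| ≤ n := by
  have h := Int.emod_add_mul_ediv (2 * a + n) (2 * n)
  have h0 := Int.emod_nonneg (2 * a + n) (show 2 * n ≠ 0 by positivity)
  have h1 := Int.emod_lt_of_pos (2 * a + n) (show 0 < 2 * n by positivity)
  refine ⟨(2 * a + n) / (2 * n), ?_⟩
  have : |a - (2 * a + n) / (2 * n) * n| * 2 = |2 * (a - (2 * a + n) / (2 * n) * n)| := by
    rw [abs_mul]; norm_num [mul_comm]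
  rw [mul_comm, this, abs_le]
  constructor <;> nlinarith

/-- If `s` is so far from the multiples of `n` that rounding fails, rounding `2 * s` succeeds. -/
theorem lt_sq_of_le_sq_of_two_mul_abs_le {D n r s r' : ℤ} (hD : D ≤ 6)
    (hn : 0 < n) (hr : 2 * |r| ≤ n) (hs : 2 * |s| ≤ n) (hr' : 2 * |r'| ≤ n)
    (h : n ^ 2 ≤ r ^ 2 + D * s ^ 2) :
    r' ^ 2 + D * (2 * |s| - n) ^ 2 < n ^ 2 := by
  rw [← sq_abs r, ← sq_abs s] at h
  rw [← sq_abs r']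
  have hr0 := abs_nonneg r
  have hr'0 := abs_nonneg r'
  have hs0 := abs_nonneg s
  generalize |r| = r at *
  generalize |r'| = r' at *
  generalize |s| = u at *
  have h1 : 4 * r ^ 2 ≤ n ^ 2 := by nlinarith
  have h2 : 4 * r' ^ 2 ≤ n ^ 2 := by nlinarith
  have h3 : D * u ^ 2 ≤ 6 * u ^ 2 := by gcongr
  have h4 : D * (2 * u - n) ^ 2 ≤ 6 * (2 * u - n) ^ 2 := by gcongr
  have h5 : n ≤ 3 * u := by nlinarith
  have h6 : 9 * (2 * u - n) ^ 2 ≤ n ^ 2 := by nlinarith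
  nlinarith

theorem Zsqrtd.exists_norm_sub_mul_lt {d : ℤ} (hd : -6 ≤ d) (hd0 : d < 0) (y : ℤ√d)
    {x : ℤ√d} (hx : x ≠ 0) :
    ∃ q : ℤ√d, (y - q * x).norm < x.norm ∨ (2 * y - q * x).norm < x.norm := by
  have hn : 0 < x.norm := lt_of_le_of_ne (Zsqrtd.norm_nonneg hd0.le x)
    fun h => hx ((Zsqrtd.norm_eq_zero_iff hd0 x).1 h.symm)
  have key : ∀ z q : ℤ√d, (z - q * x).norm * x.norm =
      ((z * star x).re - q.re * x.norm) ^ 2 +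
        (-d) * ((z * star x).im - q.im * x.norm) ^ 2 := by
    intro z q
    simp only [Zsqrtd.norm_def, Zsqrtd.re_sub, Zsqrtd.im_sub, Zsqrtd.re_mul, Zsqrtd.im_mul,
      Zsqrtd.re_star, Zsqrtd.im_star]
    ring
  obtain ⟨a, ha⟩ := exists_two_mul_abs_sub_mul_le (y * star x).re hn
  obtain ⟨b, hb⟩ := exists_two_mul_abs_sub_mul_le (y * star x).im hn
  obtain ⟨a', ha'⟩ := exists_two_mul_abs_sub_mul_le (2 * (y * star x).re) hn
  by_cases h : (y - ⟨a, b⟩ * x).norm < x.norm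
  · exact ⟨_, Or.inl h⟩
  have h' : x.norm ^ 2 ≤ ((y * star x).re - a * x.norm) ^ 2 +
      (-d) * ((y * star x).im - b * x.norm) ^ 2 := by
    have := key y ⟨a, b⟩
    simp only at this
    rw [← this]
    nlinarith
  have hlt := lt_sq_of_le_sq_of_two_mul_abs_le (by lia) hn ha hb ha' h'
  have hre : (2 * y * star x).re = 2 * (y * star x).re := by
    rw [mul_assoc, two_mul, Zsqrtd.re_add, two_mul]
  have him : (2 * y * star x).im = 2 * (y * star x).im := by
    rw [mul_assoc, two_mul, Zsqrtd.im_add, two_mul]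
  have aux : ∃ b' : ℤ, (2 * (y * star x).im - b' * x.norm) ^ 2 =
      (2 * |(y * star x).im - b * x.norm| - x.norm) ^ 2 := by
    rcases abs_choice ((y * star x).im - b * x.norm) with e | e <;> rw [e]
    · exact ⟨2 * b + 1, by ring⟩
    · exact ⟨2 * b - 1, by ring⟩
  obtain ⟨b', hb'⟩ := aux
  refine ⟨⟨a', b'⟩, Or.inr ?_⟩
  have hk := key (2 * y) ⟨a', b'⟩
  rw [hre, him] at hk
  simp only at hk
  rw [hb'] at hk
  rw [← hk, sq] at hlt
  exact lt_of_mul_lt_mul_right hlt hn.le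

theorem Zsqrtd.exists_mem_forall_dvd_two_mul {d : ℤ} (hd : -6 ≤ d) (hd0 : d < 0)
    {I : Ideal (ℤ√d)} (hI : I ≠ ⊥) :
    ∃ x ∈ I, x ≠ 0 ∧ ∀ y ∈ I, x ∣ 2 * y := by
  obtain ⟨x, ⟨hxI, hx0⟩, hmin⟩ := exists_minimalFor_of_wellFoundedLT
    (fun x : ℤ√d => x ∈ I ∧ x ≠ 0) (fun x => x.norm.natAbs)
    (Submodule.exists_mem_ne_zero_of_ne_bot hI)
  have hzero : ∀ z ∈ I, z.norm < x.norm → z = 0 := by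
    intro z hz hlt
    by_contra hz0
    have hz' := Zsqrtd.norm_nonneg hd0.le z
    have := hmin ⟨hz, hz0⟩ (by simp only; lia)
    simp only at this
    lia
  refine ⟨x, hxI, hx0, fun y hy => ?_⟩
  obtain ⟨q, h | h⟩ := Zsqrtd.exists_norm_sub_mul_lt hd hd0 y hx0
  · have := hzero _ (I.sub_mem hy (I.mul_mem_left q hxI)) h
    rw [sub_eq_zero.1 this]
    exact ⟨2 * q, by ring⟩
  · have := hzero _ (I.sub_mem (I.mul_mem_left 2 hy) (I.mul_mem_left q hxI)) h
    rw [sub_eq_zero.1 this]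
    exact ⟨q, by ring⟩

theorem Zsqrtd.two_dvd_iff {d : ℤ} {z : ℤ√d} : 2 ∣ z ↔ 2 ∣ z.re ∧ 2 ∣ z.im := by
  exact_mod_cast Zsqrtd.intCast_dvd (d := d) 2 z

theorem Zsqrtd.eq_top_of_two_mem_of_odd_norm {d : ℤ} {J : Ideal (ℤ√d)} (h2 : 2 ∈ J)
    {z : ℤ√d} (hz : z ∈ J) (hodd : z.norm % 2 = 1) : J = ⊤ := by
  rw [Ideal.eq_top_iff_one]
  have hn : (z.norm : ℤ√d) ∈ J := by
    rw [Zsqrtd.norm_eq_mul_conj]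
    exact J.mul_mem_right _ hz
  have h1 : (1 : ℤ√d) = z.norm - (z.norm / 2 : ℤ) * 2 := by
    have := Int.emod_add_mul_ediv z.norm 2
    have h : (1 : ℤ) = z.norm - (z.norm / 2) * 2 := by lia
    exact_mod_cast congrArg (Int.cast : ℤ → ℤ√d) h
  rw [h1]
  exact J.sub_mem hn (J.mul_mem_left _ h2)

theorem Zsqrtd.eq_of_two_mem {d : ℤ} (hmod : d % 4 = 2 ∨ d % 4 = 3) {J : Ideal (ℤ√d)}
    (h2 : 2 ∈ J) : J = ⊤ ∨ J = Ideal.span {2} ∨ J = sqrtTwo d := by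
  by_cases htop : J = ⊤
  · exact Or.inl htop
  have heven : ∀ z ∈ J, z.norm % 2 = 0 := fun z hz => by
    by_contra h
    exact htop (Zsqrtd.eq_top_of_two_mem_of_odd_norm h2 hz (by lia))
  refine Or.inr ?_
  by_cases hle : ∀ z ∈ J, 2 ∣ z
  · left
    refine _root_.le_antisymm (fun z hz => Ideal.mem_span_singleton.2 (hle z hz)) ?_
    rwa [Ideal.span_singleton_le_iff_mem]
  right
  push Not at hle
  obtain ⟨w, hwJ, hw⟩ := hle
  have main : ∀ π : ℤ√d, (∀ z ∈ J, 2 ∣ z ∨ 2 ∣ z - π) → J = Ideal.span {π, 2} := by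
    intro π h
    refine _root_.le_antisymm (fun z hz => ?_) ?_
    · rw [Ideal.mem_span_pair]
      rcases h z hz with ⟨c, hc⟩ | ⟨c, hc⟩
      · exact ⟨0, c, by rw [hc]; ring⟩
      · exact ⟨1, c, by rw [sub_eq_iff_eq_add.1 hc]; ring⟩
    · rw [Ideal.span_le, Set.insert_subset_iff, Set.singleton_subset_iff]
      refine ⟨?_, h2⟩
      obtain ⟨c, hc⟩ := (h w hwJ).resolve_left hw
      rw [show π = w - c * 2 by rw [← sub_sub_cancel w π, hc, mul_comm]]
      exact J.sub_mem hwJ (J.mul_mem_left c h2)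
  have hsq : ∀ a : ℤ, (a * a) % 2 = a % 2 := fun a => by
    rcases Int.emod_two_eq_zero_or_one a with h | h <;> simp [Int.mul_emod, h]
  unfold sqrtTwo
  split_ifs with hd
  all_goals
    refine main _ fun z hz => ?_
    have hz' := heven z hz
    rw [Zsqrtd.norm_def] at hz'
    simp only [Zsqrtd.two_dvd_iff, Zsqrtd.re_sub, Zsqrtd.im_sub]
    have h1 := hsq z.re
    have h2 := hsq z.im
  · obtain ⟨k, rfl⟩ : ∃ k, d = 2 * k := ⟨d / 2, by lia⟩
    have : 2 * k * z.im * z.im = 2 * (k * z.im * z.im) := by ring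
    lia
  · obtain ⟨k, rfl⟩ : ∃ k, d = 2 * k + 1 := ⟨d / 2, by lia⟩
    have : (2 * k + 1) * z.im * z.im = 2 * (k * z.im * z.im) + z.im * z.im := by ring
    lia

/-- For `d` squarefree with `-6 ≤ d ≤ 0` and `d ≡ 2` or `3 (mod 4)` (so that `ℤ[√d]` is
the ring of integers of `ℚ(√d)`, in particular a Dedekind domain), every element of the
class group of `ℤ[√d]` is trivial or the class of the ideal `√2`; in particular the class
group has at most `2` elements. -/
theorem classGroup_eq_one_or_sqrtTwo (d : ℤ) [IsDomain (ℤ√d)] [IsDedekindDomain (ℤ√d)]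
    (hsf : Squarefree d) (hmod : d % 4 = 2 ∨ d % 4 = 3) (hle : -6 ≤ d) (hge : d ≤ 0) :
    (∀ I : ClassGroup (ℤ√d),
      I = 1 ∨ I = ClassGroup.mk0
        ⟨sqrtTwo d, mem_nonZeroDivisors_of_ne_zero (sqrtTwo_ne_zero d)⟩) ∧
    Nat.card (ClassGroup (ℤ√d)) ≤ 2 := by
  have hd0 : d < 0 := by lia
  have key : ∀ I : ClassGroup (ℤ√d), I = 1 ∨ I = ClassGroup.mk0
      ⟨sqrtTwo d, mem_nonZeroDivisors_of_ne_zero (sqrtTwo_ne_zero d)⟩ := by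
    intro C
    obtain ⟨⟨I, hI⟩, rfl⟩ := ClassGroup.mk0_surjective C
    have h20 : (2 : ℤ√d) ≠ 0 := fun h => by simpa using congrArg Zsqrtd.re h
    obtain ⟨x, hxI, hx0, hx⟩ :=
      Zsqrtd.exists_mem_forall_dvd_two_mul hle hd0 (nonZeroDivisors.ne_zero hI)
    have hdvd : Ideal.span {x} ∣ Ideal.span {2} * I := by
      rw [Ideal.dvd_iff_le]
      intro z hz
      obtain ⟨y, hy, rfl⟩ := Ideal.mem_span_singleton_mul.1 hz
      exact Ideal.mem_span_singleton.2 (hx y hy)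
    obtain ⟨J, hJ⟩ := hdvd
    have h2J : 2 ∈ J := by
      have h : 2 * x ∈ Ideal.span {x} * J :=
        hJ ▸ Ideal.mem_span_singleton_mul.2 ⟨x, hxI, rfl⟩
      obtain ⟨y, hy, hyx⟩ := Ideal.mem_span_singleton_mul.1 h
      rw [mul_comm] at hyx
      rwa [← mul_right_cancel₀ hx0 hyx]
    rcases Zsqrtd.eq_of_two_mem hmod h2J with rfl | rfl | rfl
    · left
      rw [← map_one ClassGroup.mk0, ClassGroup.mk0_eq_mk0_iff]
      exact ⟨2, x, h20, hx0, by simpa using hJ⟩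
    · left
      rw [← map_one ClassGroup.mk0, ClassGroup.mk0_eq_mk0_iff]
      refine ⟨2, x * 2, h20, mul_ne_zero hx0 h20, ?_⟩
      simpa [Ideal.span_singleton_mul_span_singleton] using hJ
    · right
      rw [ClassGroup.mk0_eq_mk0_iff]
      exact ⟨2, x, h20, hx0, hJ⟩
  refine ⟨key, ?_⟩
  have huniv : (Set.univ : Set (ClassGroup (ℤ√d))) = {1, ClassGroup.mk0
      ⟨sqrtTwo d, mem_nonZeroDivisors_of_ne_zero (sqrtTwo_ne_zero d)⟩} :=
    (Set.eq_univ_of_forall key).symm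
  rw [← Set.ncard_univ, huniv]
  exact (Set.ncard_insert_le _ _).trans (by rw [Set.ncard_singleton])
end

section
/- Let d be a squarefree integer with d < −2 and d ≡ 2 or 3 (mod 4), and define the ideal √2 of ℤ[√d] as ⟨√d, 2⟩ if d ≡ 2 (mod 4) and ⟨1 + √d, 2⟩ if d ≡ 3 (mod 4). Then the class of √2 in the class group of ℤ[√d] has order exactly 2; in particular √2 is not a principal ideal. -/
open scoped nonZeroDivisors

/-- If `x` satisfies an Eisenstein-like quadratic equation at `2`, then `⟨x, 2⟩² = ⟨2⟩`. -/
theorem Ideal.span_pair_two_sq {R : Type*} [CommRing R] {x a k : R}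
    (hx : x * x = 2 * a * x + 4 * k + 2) :
    Ideal.span {x, 2} ^ 2 = Ideal.span {(2 : R)} := by
  rw [sq, Ideal.span_pair_mul_span_pair]
  apply le_antisymm
  · rw [Ideal.span_le]
    rintro y (rfl | rfl | rfl | rfl) <;> rw [SetLike.mem_coe, Ideal.mem_span_singleton']
    · exact ⟨a * x + 2 * k + 1, by rw [hx]; ring⟩
    · exact ⟨x, rfl⟩
    · exact ⟨x, mul_comm _ _⟩
    · exact ⟨2, rfl⟩
  · rw [Ideal.span_singleton_le_iff_mem]
    have h : (2 : R) = x * x - a * (x * 2) - k * (2 * 2) := by rw [hx]; ring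
    rw [h]
    refine sub_mem (sub_mem ?_ (Ideal.mul_mem_left _ _ ?_)) (Ideal.mul_mem_left _ _ ?_) <;>
      exact Ideal.subset_span (by simp [← h])

theorem sqrtTwo_sq {d : ℤ} (hmod : d % 4 = 2 ∨ d % 4 = 3) :
    sqrtTwo d ^ 2 = Ideal.span {(2 : ℤ√d)} := by
  unfold sqrtTwo
  split_ifs with h
  · refine Ideal.span_pair_two_sq (a := 0) (k := ((d / 4 : ℤ) : ℤ√d)) ?_
    ext
    · simp
      omega
    · simp
  · refine Ideal.span_pair_two_sq (a := 1) (k := ((d / 4 : ℤ) : ℤ√d)) ?_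
    ext
    · simp
      omega
    · simp

theorem Zsqrtd.norm_ne_two {d : ℤ} (hd : d < -2) (z : ℤ√d) : z.norm ≠ 2 := by
  intro h
  rw [Zsqrtd.norm_def] at h
  have him : z.im = 0 := by
    by_contra h0
    have : 0 < z.im ^ 2 := by positivity
    nlinarith [sq_nonneg z.re]
  rw [him] at h
  have h₁ : z.re < 2 := by nlinarith
  have h₂ : -2 < z.re := by nlinarith
  interval_cases z.re <;> omega

theorem not_isPrincipal_sqrtTwo {d : ℤ} (hlt : d < -2) (hmod : d % 4 = 2 ∨ d % 4 = 3)
    [IsDomain (ℤ√d)] : ¬ (sqrtTwo d).IsPrincipal := by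
  rintro ⟨g, hg⟩
  have hsq := sqrtTwo_sq hmod
  rw [hg, Ideal.submodule_span_eq, Ideal.span_singleton_pow,
    Ideal.span_singleton_eq_span_singleton] at hsq
  have hn := Zsqrtd.norm_eq_of_associated (by omega) hsq
  have h2 : (2 : ℤ√d).norm = 4 := by simp [Zsqrtd.norm_def]
  rw [sq, Zsqrtd.norm_mul, h2] at hn
  have h0 := Zsqrtd.norm_nonneg (by omega) g
  exact Zsqrtd.norm_ne_two hlt g (by nlinarith)

/-- For `d` squarefree with `d < -2` and `d ≡ 2` or `3 (mod 4)` (so that `ℤ[√d]` is the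
ring of integers of `ℚ(√d)`, in particular a Dedekind domain), the class of the ideal `√2`
in the class group of `ℤ[√d]` has order exactly `2`; in particular `√2` is not principal. -/
theorem orderOf_sqrtTwo (d : ℤ) [IsDomain (ℤ√d)] [IsDedekindDomain (ℤ√d)]
    (hsf : Squarefree d) (hlt : d < -2) (hmod : d % 4 = 2 ∨ d % 4 = 3) :
    orderOf (ClassGroup.mk0
        ⟨sqrtTwo d, mem_nonZeroDivisors_of_ne_zero (sqrtTwo_ne_zero d)⟩) = 2 ∧
      ¬ (sqrtTwo d).IsPrincipal := by
  have hnp := not_isPrincipal_sqrtTwo hlt hmod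
  refine ⟨orderOf_eq_prime ?_ ?_, hnp⟩
  · rw [← map_pow, SubmonoidClass.mk_pow, ClassGroup.mk0_eq_one_iff, sqrtTwo_sq hmod]
    exact ⟨2, rfl⟩
  · rwa [Ne, ClassGroup.mk0_eq_one_iff]
end

section
/- Let d be a squarefree integer with d ≡ 3 (mod 4) and d ≤ −1, and let x, y be integers with y² − d = x³. Then the ideals ⟨y + √d⟩ and ⟨y − √d⟩ of ℤ[√d] are coprime: their greatest common divisor (as ideals in the Dedekind domain ℤ[√d]) is the unit ideal. -/
theorem isCoprime_of_sq_sub_eq_cube {d x y : ℤ} (hsf : Squarefree d)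
    (h : y ^ 2 - d = x ^ 3) : IsCoprime x y := by
  rw [← gcd_isUnit_iff]
  apply hsf
  obtain ⟨a, ha⟩ := gcd_dvd_left x y
  obtain ⟨b, hb⟩ := gcd_dvd_right x y
  generalize gcd x y = g at *
  subst ha hb
  exact ⟨b ^ 2 - g * a ^ 3, by linear_combination -h⟩

theorem odd_of_sq_sub_eq_cube {d x y : ℤ} (hmod : d % 4 = 3)
    (h : y ^ 2 - d = x ^ 3) : Odd x := by
  by_contra hx
  obtain ⟨k, rfl⟩ := even_iff_two_dvd.mp (Int.not_odd_iff_even.mp hx)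
  have hd : y ^ 2 = d + 4 * (2 * k ^ 3) := by linear_combination h
  rcases Int.even_or_odd' y with ⟨m, rfl | rfl⟩ <;> ring_nf at hd <;> omega

/-- Let `d` be a squarefree integer with `d ≡ 3 (mod 4)` and `d ≤ -1`, and `x, y` integers
with `y² − d = x³`. Then the ideals `⟨y + √d⟩` and `⟨y − √d⟩` of `ℤ[√d]` are coprime:
their gcd (which, for ideals of the Dedekind domain `ℤ[√d]`, is their sum) is the
unit ideal. -/
theorem gcd_span_eq_top (d : ℤ) (hsf : Squarefree d) (hmod : d % 4 = 3) (hd : d ≤ -1)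
    (x y : ℤ) (h_eqn : y ^ 2 - d = x ^ 3) :
    Ideal.span {(⟨y, 1⟩ : ℤ√d)} ⊔ Ideal.span {(⟨y, -1⟩ : ℤ√d)} = ⊤ := by
  have hcop : IsCoprime (x ^ 3) (2 * y) :=
    ((Int.isCoprime_two_right.mpr (odd_of_sq_sub_eq_cube hmod h_eqn)).mul_right
      (isCoprime_of_sq_sub_eq_cube hsf h_eqn)).pow_left
  obtain ⟨a, b, hab⟩ := hcop
  rw [← h_eqn] at hab
  rw [← Ideal.isCoprime_iff_sup_eq, Ideal.isCoprime_span_singleton_iff]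
  refine ⟨a * ⟨y, -1⟩ + b, b, ?_⟩
  ext
  · simp
    linear_combination hab
  · simp
end
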